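/- For every natural number n and every real number a > 0, ∫_{0}^{1} ( ln(x/(1−x)) )ⁿ / (x + a) dx = −π^{n+1}·A_n(γ_a/π), where γ_a = ln(a/(1+a)), the integral is taken over the open interval (0,1), and A_n(γ_a/π) denotes evaluation of A_n at the complex number γ_a/π. -/

import Mathlib

open Polynomial Finset

/-- The pair of polynomial sequences (Aₙ, Cₙ) from the paper:
A₀ = X, C₀ = 0, and
A_{n+1} = ((n+1)/(n+2))·(X·Aₙ + ∑_{k=0}^{n} λₙᵏ·A_k),
C_{n+1} = ((n+1)/(n+2))·((X²+1)·Xⁿ + ∑_{k=0}^{n} λₙᵏ·C_k),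
where λₙᵏ is the coefficient of Xᵏ in Cₙ. -/
noncomputable def AC : ℕ → Polynomial ℂ × Polynomial ℂ
  | 0 => (Polynomial.X, 0)
  | (n+1) =>
    (((n+1 : ℂ)/(n+2)) • (Polynomial.X * (AC n).1 +
        ∑ k ∈ (Finset.range (n+1)).attach, ((AC n).2.coeff k) • (AC k).1),
     ((n+1 : ℂ)/(n+2)) • ((Polynomial.X^2 + 1) * Polynomial.X^n +
        ∑ k ∈ (Finset.range (n+1)).attach, ((AC n).2.coeff k) • (AC k).2))
  decreasing_by
  all_goals first
    | exact Nat.lt_succ_self n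
    | exact Nat.lt_succ_of_lt (Finset.mem_range.mp k.2)
    | exact Finset.mem_range.mp k.2

noncomputable def polyA (n : ℕ) : Polynomial ℂ := (AC n).1
noncomputable def polyC (n : ℕ) : Polynomial ℂ := (AC n).2


/-! ### Recursion for the polynomials -/

lemma polyA_zero : polyA 0 = X := by simp [polyA, AC]

lemma polyC_zero : polyC 0 = 0 := by simp [polyC, AC]

lemma polyA_succ (n : ℕ) : polyA (n+1) = ((n+1 : ℂ)/(n+2)) • (X * polyA n +
    ∑ k ∈ range (n+1), ((polyC n).coeff k) • polyA k) := by
  simp only [polyA, polyC]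
  rw [AC]
  simp only
  rw [Finset.sum_attach (range (n+1)) (fun k => ((AC n).2.coeff k) • (AC k).1)]

lemma polyC_succ (n : ℕ) : polyC (n+1) = ((n+1 : ℂ)/(n+2)) • ((X^2+1) * X^n +
    ∑ k ∈ range (n+1), ((polyC n).coeff k) • polyC k) := by
  simp only [polyC]
  rw [AC]
  simp only
  rw [Finset.sum_attach (range (n+1)) (fun k => ((AC n).2.coeff k) • (AC k).2)]

/-! ### Generating series -/

/-- exponential generating series of `A` at a point. -/
noncomputable def serA (z : ℂ) : PowerSeries ℂ :=
  PowerSeries.mk fun n => (polyA n).eval z / (n.factorial : ℂ)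

/-- `exp (z s)`. -/
noncomputable def serE (z : ℂ) : PowerSeries ℂ :=
  PowerSeries.mk fun n => z ^ n / (n.factorial : ℂ)

/-- The closed form of `C n / n!`. -/
noncomputable def cpoly (P Q : PowerSeries ℂ) (n : ℕ) : Polynomial ℂ :=
  Polynomial.C (1 / (n.factorial : ℂ)) * X ^ (n+1)
   - ∑ k ∈ range (n+2),
      Polynomial.C (PowerSeries.coeff (n+1-k) P / (k.factorial : ℂ)) * X ^ k
   + Polynomial.C (PowerSeries.coeff (n+1) Q)

lemma derivative_serE (z : ℂ) : PowerSeries.derivative ℂ (serE z) = PowerSeries.C z * serE z := by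
  ext n
  rw [PowerSeries.coeff_derivative, PowerSeries.coeff_C_mul, serE, PowerSeries.coeff_mk, PowerSeries.coeff_mk, Nat.factorial_succ]
  have : (n.factorial : ℂ) ≠ 0 := by exact_mod_cast n.factorial_ne_zero
  have h2 : (n + 1 : ℂ) ≠ 0 := by exact_mod_cast n.succ_ne_zero
  push_cast
  field_simp
  ring

/-- Uniqueness for `H' = z H`, `H 0 = 1`. -/
lemma eq_serE (z : ℂ) (H : PowerSeries ℂ) (h0 : PowerSeries.coeff 0 H = 1)
    (h : PowerSeries.derivative ℂ H = PowerSeries.C z * H) : H = serE z := by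
  ext n
  induction n with
  | zero => rw [h0]; simp [serE]
  | succ n ih =>
    have h1 := congrArg (PowerSeries.coeff n) h
    have h2 := congrArg (PowerSeries.coeff n) (derivative_serE z)
    rw [PowerSeries.coeff_derivative, PowerSeries.coeff_C_mul] at h1 h2
    have h3 : (n + 1 : ℂ) ≠ 0 := by exact_mod_cast n.succ_ne_zero
    apply mul_right_cancel₀ h3
    rw [h1, h2, ih]

/-- The recursion in terms of series. -/
lemma series_rec (P Q F G : PowerSeries ℂ) (hP : PowerSeries.coeff 0 P = 1) (hQ : PowerSeries.coeff 0 Q = 1) :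
    (∀ n : ℕ, (n + 2 : ℂ) * PowerSeries.coeff (n+1) F = PowerSeries.coeff n G
      - ∑ k ∈ range (n+1), PowerSeries.coeff (n+1-k) P * PowerSeries.coeff k F + PowerSeries.coeff (n+1) Q * PowerSeries.coeff 0 F) ↔
    PowerSeries.X * PowerSeries.derivative ℂ F + P * F
      = PowerSeries.X * G + Q * PowerSeries.C (PowerSeries.coeff 0 F) := by
  have key : ∀ n : ℕ, PowerSeries.coeff (n+1) (P * F) =
      ∑ k ∈ range (n+1), PowerSeries.coeff (n+1-k) P * PowerSeries.coeff k F + PowerSeries.coeff (n+1) F := by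
    intro n
    rw [mul_comm, PowerSeries.coeff_mul, Finset.Nat.sum_antidiagonal_eq_sum_range_succ_mk,
      Finset.sum_range_succ]
    simp only [Nat.sub_self, hP, mul_one]
    congr 1
    exact Finset.sum_congr rfl fun k _ => mul_comm _ _
  constructor
  · intro h
    ext n
    cases n with
    | zero =>
      simp only [PowerSeries.coeff_zero_eq_constantCoeff] at hP hQ ⊢
      simp [hP, hQ]
    | succ n =>
      have := h n
      rw [map_add, map_add, PowerSeries.coeff_succ_X_mul, PowerSeries.coeff_succ_X_mul, key, PowerSeries.coeff_derivative,
        PowerSeries.coeff_mul_C]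
      linear_combination this
  · intro h n
    have := congrArg (PowerSeries.coeff (n+1)) h
    rw [map_add, map_add, PowerSeries.coeff_succ_X_mul, PowerSeries.coeff_succ_X_mul, key, PowerSeries.coeff_derivative,
        PowerSeries.coeff_mul_C] at this
    linear_combination this

lemma cpoly_eval (P Q : PowerSeries ℂ) (z : ℂ) (n : ℕ) :
    (cpoly P Q n).eval z = PowerSeries.coeff (n+1)
      (PowerSeries.X * (PowerSeries.C z * serE z) - P * serE z + Q) := by
  rw [map_add, map_sub, PowerSeries.coeff_succ_X_mul, PowerSeries.coeff_C_mul, mul_comm P, PowerSeries.coeff_mul,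
    Finset.Nat.sum_antidiagonal_eq_sum_range_succ_mk]
  simp only [cpoly, serE, PowerSeries.coeff_mk, Polynomial.eval_add, Polynomial.eval_sub, Polynomial.eval_mul,
    Polynomial.eval_C, Polynomial.eval_pow, Polynomial.eval_X, Polynomial.eval_finsetSum]
  congr 2
  · ring
  · exact Finset.sum_congr rfl fun k _ => by ring

lemma cpoly_coeff (P Q : PowerSeries ℂ) (n k : ℕ) (hk : k ≤ n) :
    (cpoly P Q n).coeff k = - (PowerSeries.coeff (n+1-k) P / (k.factorial : ℂ))
      + if k = 0 then PowerSeries.coeff (n+1) Q else 0 := by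
  simp only [cpoly, Polynomial.coeff_add, Polynomial.coeff_sub, Polynomial.finsetSum_coeff,
    Polynomial.coeff_C_mul, Polynomial.coeff_X_pow, Polynomial.coeff_C]
  rw [if_neg (by omega : k ≠ n+1), Finset.sum_eq_single k]
  · simp
  · intro b _ hb
    simp [Ne.symm hb]
  · intro h
    exact absurd (Finset.mem_range.2 (by omega)) h

/-- Generating function of `A`. -/
theorem serA_formula (S K : PowerSeries ℂ) (hS : PowerSeries.derivative ℂ S = K) (hK : PowerSeries.derivative ℂ K = -S)
    (hS0 : PowerSeries.coeff 0 S = 0) (hK0 : PowerSeries.coeff 0 K = 1) (z : ℂ) : S * serA z = serE z - 1 := by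
  obtain ⟨Sc, rfl⟩ : ∃ Sc, S = PowerSeries.X * Sc := by
    rw [← dvd_def]
    exact PowerSeries.X_dvd_iff.2 (by simpa using hS0)
  have hSc : PowerSeries.constantCoeff Sc = 1 := by
    have := congrArg PowerSeries.constantCoeff hS
    simp only [PowerSeries.coeff_zero_eq_constantCoeff] at hK0
    rw [hK0] at this
    simpa using this
  set Q := Sc⁻¹ with hQdef
  have hQSc : Sc * Q = 1 := PowerSeries.mul_inv_cancel _ (by rw [hSc]; exact one_ne_zero)
  have hSc_ne : Sc ≠ 0 := by
    rintro rfl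
    simp at hSc
  have hX : (PowerSeries.X : PowerSeries ℂ) ≠ 0 := PowerSeries.X_ne_zero
  have hQ0 : PowerSeries.coeff 0 Q = 1 := by
    have := congrArg PowerSeries.constantCoeff hQSc
    simpa [hSc] using this
  set P := K * Q with hPdef
  have hP0 : PowerSeries.coeff 0 P = 1 := by
    simp only [PowerSeries.coeff_zero_eq_constantCoeff] at hK0 hQ0 ⊢
    simp [hPdef, hK0, hQ0]
  have hPSc : Sc * P = K := by rw [hPdef, mul_left_comm, hQSc, mul_one]
  -- the closed form of C
  set c := cpoly P Q with hc
  have hE0 : ∀ w, PowerSeries.constantCoeff (serE w) = 1 := by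
    intro w
    rw [← PowerSeries.coeff_zero_eq_constantCoeff_apply]
    simp [serE]
  have hc0 : c 0 = 0 := by
    apply Polynomial.funext
    intro w
    rw [hc, cpoly_eval]
    have h1 : PowerSeries.X * (PowerSeries.C w * serE w) - P * serE w + Q
      = Q * (1 - K * serE w + PowerSeries.X * Sc * (PowerSeries.C w * serE w)) := by
      rw [hPdef]
      linear_combination (-PowerSeries.X * (PowerSeries.C w * serE w)) * hQSc
    rw [h1]
    have h3 : PowerSeries.constantCoeff (1 - K * serE w + PowerSeries.X * Sc * (PowerSeries.C w * serE w)) = 0 := by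
      simp only [PowerSeries.coeff_zero_eq_constantCoeff] at hK0
      simp [hK0, hE0]
    have h4 : PowerSeries.coeff 1 (1 - K * serE w + PowerSeries.X * Sc * (PowerSeries.C w * serE w)) = 0 := by
      have hd : PowerSeries.derivative ℂ (1 - K * serE w + PowerSeries.X * Sc * (PowerSeries.C w * serE w))
          = PowerSeries.X * Sc * ((1 + PowerSeries.C w ^ 2) * serE w) := by
        simp only [map_add, map_sub, Derivation.leibniz (PowerSeries.derivative ℂ) (PowerSeries.X * Sc),
          hS, Derivation.leibniz (PowerSeries.derivative ℂ) K, hK,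
          Derivation.leibniz (PowerSeries.derivative ℂ) (PowerSeries.C w),
          derivative_serE, smul_eq_mul, Derivation.map_one_eq_zero, PowerSeries.derivative_C]
        ring
      have h5 := congrArg (PowerSeries.coeff 0) hd
      rw [PowerSeries.coeff_derivative,
        mul_assoc PowerSeries.X Sc ((1 + PowerSeries.C w ^ 2) * serE w),
        PowerSeries.coeff_zero_X_mul] at h5
      simpa only [Nat.cast_zero, zero_add, mul_one] using h5
    obtain ⟨T, hT⟩ := PowerSeries.X_dvd_iff.2 h3
    rw [hT] at h4 ⊢
    rw [← zero_add 1, PowerSeries.coeff_succ_X_mul] at h4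
    rw [mul_left_comm, PowerSeries.coeff_succ_X_mul]
    simp only [PowerSeries.coeff_zero_eq_constantCoeff] at h4 ⊢
    simp [h4]
  have hF : ∀ w : ℂ, PowerSeries.X * (PowerSeries.mk fun n => (c n).eval w) =
      PowerSeries.X * (PowerSeries.C w * serE w) - P * serE w + Q := by
    intro w
    ext n
    cases n with
    | zero =>
      simp only [PowerSeries.coeff_zero_eq_constantCoeff] at hP0 hQ0 ⊢
      simp [hP0, hQ0, hE0]
    | succ n => rw [PowerSeries.coeff_succ_X_mul, PowerSeries.coeff_mk, hc, cpoly_eval]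
  have hcrec : ∀ (n : ℕ), Polynomial.C (n + 2 : ℂ) * c (n+1) =
      Polynomial.C (1 / (n.factorial : ℂ)) * ((X^2+1) * X^n)
      - ∑ k ∈ range (n+1), Polynomial.C (PowerSeries.coeff (n+1-k) P) * c k := by
    intro n
    apply Polynomial.funext
    intro w
    set F := (PowerSeries.mk fun n => (c n).eval w) with hFdef
    have hF0 : PowerSeries.coeff 0 F = 0 := by simp [hFdef, hc0]
    have hSF : PowerSeries.X * Sc * F = PowerSeries.X * Sc * (PowerSeries.C w * serE w)
        - K * serE w + 1 := by
      linear_combination Sc * hF w - serE w * hPSc + hQSc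
    have hode : PowerSeries.X * PowerSeries.derivative ℂ F + P * F
      = PowerSeries.X * (PowerSeries.C (w^2+1) * serE w) + Q * PowerSeries.C (PowerSeries.coeff 0 F) := by
      have h6 := congrArg (PowerSeries.derivative ℂ) hSF
      rw [Derivation.leibniz, hS] at h6
      simp only [map_add, map_sub, Derivation.leibniz (PowerSeries.derivative ℂ) (PowerSeries.X * Sc), hS,
        Derivation.leibniz (PowerSeries.derivative ℂ) K, hK, Derivation.leibniz (PowerSeries.derivative ℂ) (PowerSeries.C w),
          derivative_serE, smul_eq_mul, Derivation.map_one_eq_zero, PowerSeries.derivative_C] at h6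
      rw [hF0]
      apply mul_left_cancel₀ hSc_ne
      simp only [map_zero, map_add, map_pow, map_one, mul_zero, add_zero]
      linear_combination h6 + F * hPSc
    have h7 := (series_rec P Q F _ hP0 hQ0).2 hode n
    rw [hF0, PowerSeries.coeff_C_mul] at h7
    simp only [hFdef, serE, PowerSeries.coeff_mk] at h7
    simp only [Polynomial.eval_sub, Polynomial.eval_mul, Polynomial.eval_C, Polynomial.eval_add,
      Polynomial.eval_pow, Polynomial.eval_X, Polynomial.eval_one, Polynomial.eval_finsetSum]
    linear_combination h7
  have hfac : ∀ n : ℕ, (n.factorial : ℂ) ≠ 0 := fun n => by exact_mod_cast n.factorial_ne_zero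
  have hC : ∀ n, polyC n = Polynomial.C (n.factorial : ℂ) * c n := by
    intro n
    induction n using Nat.strong_induction_on with
    | _ n ih =>
      cases n with
      | zero => rw [polyC_zero, hc0, mul_zero]
      | succ n =>
        have h1 : ∑ k ∈ range (n+1), ((polyC n).coeff k) • polyC k =
            - (Polynomial.C (n.factorial : ℂ) *
              ∑ k ∈ range (n+1), Polynomial.C (PowerSeries.coeff (n+1-k) P) * c k) := by
          rw [Finset.mul_sum, ← Finset.sum_neg_distrib]
          refine Finset.sum_congr rfl fun k hk => ?_
          have hk' := Finset.mem_range.1 hk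
          rw [ih n (by omega), ih k hk', Polynomial.coeff_C_mul, hc,
            cpoly_coeff P Q n k (by omega), ← hc, Polynomial.smul_eq_C_mul]
          by_cases h0 : k = 0
          · subst h0
            rw [hc0]
            simp
          · rw [if_neg h0]
            have := hfac k
            rw [← mul_assoc, ← Polynomial.C_mul, ← mul_assoc, ← Polynomial.C_mul, ← neg_mul,
              ← Polynomial.C_neg]
            congr 2
            field_simp
            ring
        rw [polyC_succ, h1]
        have h2 : ((n:ℂ) + 2) ≠ 0 := by exact_mod_cast (by omega : n + 2 ≠ 0)
        have h3 := hcrec n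
        apply Polynomial.funext
        intro w
        have h4 := congrArg (Polynomial.eval w) h3
        simp only [Polynomial.eval_sub, Polynomial.eval_mul, Polynomial.eval_C, Polynomial.eval_add,
          Polynomial.eval_pow, Polynomial.eval_X, Polynomial.eval_one, Polynomial.eval_smul,
          Polynomial.eval_neg, smul_eq_mul] at h4 ⊢
        rw [Nat.factorial_succ]
        push_cast
        have := hfac n
        field_simp at h4 ⊢
        linear_combination -h4
  -- now A
  have hA0 : PowerSeries.coeff 0 (serA z) = z := by simp [serA, polyA_zero]
  have hA : PowerSeries.X * PowerSeries.derivative ℂ (serA z) + P * serA z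
      = PowerSeries.X * (PowerSeries.C z * serA z) + Q * PowerSeries.C (PowerSeries.coeff 0 (serA z)) := by
    rw [← series_rec P Q _ _ hP0 hQ0]
    intro n
    have h1 : ∑ k ∈ range (n+1), (polyC n).coeff k * (polyA k).eval z =
        (n.factorial : ℂ) * (- ∑ k ∈ range (n+1), PowerSeries.coeff (n+1-k) P * PowerSeries.coeff k (serA z)
           + PowerSeries.coeff (n+1) Q * PowerSeries.coeff 0 (serA z)) := by
      have h2 : ∀ k ∈ range (n+1), (polyC n).coeff k * (polyA k).eval z =
         (n.factorial : ℂ) * (- (PowerSeries.coeff (n+1-k) P * PowerSeries.coeff k (serA z))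
          + if k = 0 then PowerSeries.coeff (n+1) Q * PowerSeries.coeff 0 (serA z) else 0) := by
        intro k hk
        have hk' := Finset.mem_range.1 hk
        rw [hC n, Polynomial.coeff_C_mul, hc, cpoly_coeff P Q n k (by omega)]
        simp only [serA, PowerSeries.coeff_mk]
        by_cases h0 : k = 0
        · subst h0
          simp
          ring
        · rw [if_neg h0, if_neg h0]
          have := hfac k
          field_simp
          ring
      rw [Finset.sum_congr rfl h2, ← Finset.mul_sum, Finset.sum_add_distrib,
        Finset.sum_neg_distrib]
      simp
    have h3 := congrArg (Polynomial.eval z) (polyA_succ n)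
    simp only [Polynomial.eval_mul, Polynomial.eval_add, Polynomial.eval_X, Polynomial.eval_smul,
      smul_eq_mul, Polynomial.eval_finsetSum] at h3
    rw [h1] at h3
    rw [PowerSeries.coeff_C_mul]
    have e1 : PowerSeries.coeff (n+1) (serA z) = (polyA (n+1)).eval z / ((n+1).factorial : ℂ) := by simp [serA]
    have e2 : PowerSeries.coeff n (serA z) = (polyA n).eval z / (n.factorial : ℂ) := by simp [serA]
    rw [e1, e2, h3, Nat.factorial_succ]
    have h2 : ((n:ℂ) + 2) ≠ 0 := by exact_mod_cast (by omega : n + 2 ≠ 0)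
    have h5 : ((n:ℂ) + 1) ≠ 0 := by exact_mod_cast (by omega : n + 1 ≠ 0)
    have := hfac n
    push_cast
    field_simp
    ring
  rw [hA0] at hA
  have hfin : PowerSeries.X * Sc * serA z + 1 = serE z := by
    apply eq_serE
    · simp
    · rw [map_add, Derivation.leibniz, hS, Derivation.map_one_eq_zero, smul_eq_mul, smul_eq_mul]
      linear_combination Sc * hA - serA z * hPSc + PowerSeries.C z * hQSc
  rw [← hfin]
  ring

/-! ### Analysis -/

lemma beta_congr (p q : ℝ) : Set.EqOn
    (fun x : ℝ => (x:ℂ) ^ ((p:ℂ) - 1) * (1 - (x:ℂ)) ^ ((q:ℂ) - 1))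
    (fun x : ℝ => ((x ^ (p-1) * (1-x) ^ (q-1) : ℝ) : ℂ)) (Set.Ioo 0 1) := by
  intro x hx
  simp only
  rw [Complex.ofReal_mul, Complex.ofReal_cpow hx.1.le, Complex.ofReal_cpow (by linarith [hx.2])]
  push_cast
  rfl

lemma beta_integrable {p q : ℝ} (hp : 0 < p) (hq : 0 < q) :
    MeasureTheory.IntegrableOn (fun x : ℝ => x ^ (p-1) * (1-x) ^ (q-1)) (Set.Ioo 0 1) := by
  have h := Complex.betaIntegral_convergent (u := p) (v := q) (by simpa) (by simpa)
  rw [intervalIntegrable_iff_integrableOn_Ioo_of_le zero_le_one] at h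
  have h2 := (MeasureTheory.integrableOn_congr_fun (beta_congr p q) measurableSet_Ioo).1 h
  have h3 := h2.re
  simpa [MeasureTheory.IntegrableOn] using h3

lemma beta_value {s : ℝ} (h0 : 0 < s) (h1 : s < 1) :
    ∫ x in Set.Ioo (0:ℝ) 1, x ^ (s-1) * (1-x) ^ (-s) = Real.pi / Real.sin (Real.pi * s) := by
  have h := Complex.betaIntegral_eq_Gamma_mul_div (s:ℂ) ((1 - s : ℝ):ℂ) (by simpa)
    (by rw [Complex.ofReal_re]; linarith)
  rw [Complex.betaIntegral, intervalIntegral.integral_of_le zero_le_one,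
    MeasureTheory.integral_Ioc_eq_integral_Ioo,
    MeasureTheory.setIntegral_congr_fun measurableSet_Ioo (beta_congr s (1-s)),
    integral_complex_ofReal] at h
  push_cast at h
  rw [Complex.Gamma_mul_Gamma_one_sub] at h
  have h4 : (s:ℂ) + (1 - s) = 1 := by ring
  rw [h4, Complex.Gamma_one, div_one] at h
  have h5 : (1 - s - 1 : ℝ) = -s := by ring
  rw [h5] at h
  exact_mod_cast h

lemma moebius_cov (g : ℝ → ℝ) : ∫ x in Set.Ioo (0:ℝ) 1, g x =
    ∫ u in Set.Ioi (0:ℝ), 1 / (1+u)^2 * g (u / (1+u)) := by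
  have himg : (fun u : ℝ => u / (1+u)) '' Set.Ioi 0 = Set.Ioo 0 1 := by
    ext x
    simp only [Set.mem_image, Set.mem_Ioi, Set.mem_Ioo]
    constructor
    · rintro ⟨u, hu, rfl⟩
      refine ⟨by positivity, ?_⟩
      rw [div_lt_one (by positivity)]
      linarith
    · rintro ⟨h0, h1⟩
      have h2 : 1 - x ≠ 0 := by linarith
      refine ⟨x / (1-x), div_pos h0 (by linarith), ?_⟩
      field_simp
      ring
  have hinj : Set.InjOn (fun u : ℝ => u / (1+u)) (Set.Ioi 0) := by
    intro u hu v hv h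
    simp only [Set.mem_Ioi] at hu hv
    rw [div_eq_div_iff (by positivity) (by positivity)] at h
    linarith
  rw [← himg, MeasureTheory.integral_image_eq_integral_abs_deriv_smul measurableSet_Ioi
    (f' := fun u => 1 / (1+u)^2) _ hinj]
  · refine MeasureTheory.setIntegral_congr_fun measurableSet_Ioi fun u hu => ?_
    simp only [Set.mem_Ioi] at hu
    simp only [smul_eq_mul]
    rw [abs_of_pos (by positivity)]
  · intro u hu
    simp only [Set.mem_Ioi] at hu
    have h1 : (1 + u) ≠ 0 := by positivity
    have h2 : HasDerivAt (fun u : ℝ => u / (1+u)) ((1 * (1+u) - u * 1) / (1+u)^2) u :=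
      (hasDerivAt_id' u).div ((hasDerivAt_id' u).const_add 1) h1
    have h3 : (1 * (1+u) - u * 1) / (1+u)^2 = 1 / (1+u)^2 := by ring
    rw [h3] at h2
    exact h2.hasDerivWithinAt

lemma J_value {s : ℝ} (h0 : 0 < s) (h1 : s < 1) :
    ∫ u in Set.Ioi (0:ℝ), u ^ (s-1) / (1+u) = Real.pi / Real.sin (Real.pi * s) := by
  rw [← beta_value h0 h1, moebius_cov]
  refine MeasureTheory.setIntegral_congr_fun measurableSet_Ioi fun u hu => ?_
  simp only [Set.mem_Ioi] at hu
  have h1 : 0 < 1 + u := by positivity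
  have h2 : 1 - u / (1+u) = (1+u)⁻¹ := by field_simp; ring
  rw [h2, Real.div_rpow hu.le h1.le, Real.inv_rpow h1.le, Real.rpow_neg h1.le, inv_inv,
    Real.rpow_sub_one h1.ne' s]
  have : (1+u)^s ≠ 0 := (Real.rpow_pos_of_pos h1 s).ne'
  field_simp

lemma sin_pi_pos {s : ℝ} (h0 : 0 < s) (h1 : s < 1) : 0 < Real.sin (Real.pi * s) :=
  Real.sin_pos_of_pos_of_lt_pi (by positivity) (by nlinarith [Real.pi_pos])

lemma J_integrable {s : ℝ} (h0 : 0 < s) (h1 : s < 1) :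
    MeasureTheory.IntegrableOn (fun u : ℝ => u ^ (s-1) / (1+u)) (Set.Ioi 0) := by
  by_contra h
  have h2 := MeasureTheory.integral_undef h
  rw [J_value h0 h1] at h2
  have := div_pos Real.pi_pos (sin_pi_pos h0 h1)
  linarith

lemma mgf_value {t a : ℝ} (h0 : 0 < t) (h1 : t < 1) (ha : 0 < a) :
    ∫ x in Set.Ioo (0:ℝ) 1, Real.exp (t * Real.log (x / (1-x))) / (x + a) =
      Real.pi / Real.sin (Real.pi * t) * (1 - Real.exp (t * Real.log (a / (1+a)))) := by
  set b : ℝ := (1+a)/a with hb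
  have hb0 : 0 < b := by positivity
  rw [moebius_cov]
  have hJb : MeasureTheory.IntegrableOn (fun u : ℝ => b * ((b*u) ^ (t-1) / (1+b*u))) (Set.Ioi 0) := by
    have h3 := (MeasureTheory.integrableOn_Ioi_comp_mul_left_iff
      (fun u : ℝ => u ^ (t-1) / (1+u)) 0 hb0).2 (by rw [mul_zero]; exact J_integrable h0 h1)
    exact h3.const_mul b
  have hJv : ∫ u in Set.Ioi (0:ℝ), b * ((b*u) ^ (t-1) / (1+b*u))
      = Real.pi / Real.sin (Real.pi * t) := by
    rw [MeasureTheory.integral_const_mul,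
      MeasureTheory.integral_comp_mul_left_Ioi (fun u : ℝ => u ^ (t-1) / (1+u)) 0 hb0,
      mul_zero, J_value h0 h1, smul_eq_mul]
    field_simp
  have hexp : Real.exp (t * Real.log (a / (1+a))) = b ^ (-t) := by
    rw [Real.rpow_def_of_pos hb0, hb, ← inv_div a (1+a), Real.log_inv]
    congr 1
    ring
  rw [hexp]
  have hfin : ∀ u ∈ Set.Ioi (0:ℝ),
      1 / (1+u)^2 * (Real.exp (t * Real.log (u / (1+u) / (1 - u / (1+u)))) / (u/(1+u) + a)) =
      u ^ (t-1) / (1+u) - b ^ (-t) * (b * ((b*u) ^ (t-1) / (1+b*u))) := by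
    intro u hu
    simp only [Set.mem_Ioi] at hu
    have h3 : 0 < 1 + u := by positivity
    have h4 : u / (1+u) / (1 - u / (1+u)) = u := by
      field_simp
      ring
    rw [h4, mul_comm t, ← Real.rpow_def_of_pos hu, Real.mul_rpow hb0.le hu.le,
      Real.rpow_sub_one hb0.ne', Real.rpow_neg hb0.le, Real.rpow_sub_one hu.ne']
    have h5 : b ^ t ≠ 0 := (Real.rpow_pos_of_pos hb0 t).ne'
    have h6 : (1 + b * u) = (a + (1+a)*u)/a := by rw [hb]; field_simp
    rw [h6]
    have h7 : u/(1+u) + a = (a + (1+a)*u)/(1+u) := by field_simp; ring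
    rw [h7]
    have h8 : a + (1+a)*u ≠ 0 := by positivity
    field_simp
    ring
  rw [MeasureTheory.setIntegral_congr_fun measurableSet_Ioi hfin,
    MeasureTheory.integral_sub (J_integrable h0 h1) (hJb.const_mul _),
    MeasureTheory.integral_const_mul (b ^ (-t)), hJv, J_value h0 h1]
  ring

lemma mgf_integrable {t a : ℝ} (h0 : -1 < t) (h1 : t < 1) (ha : 0 < a) :
    MeasureTheory.IntegrableOn
      (fun x => Real.exp (t * Real.log (x / (1-x))) / (x + a)) (Set.Ioo 0 1) := by
  have h := (beta_integrable (p := 1 + t) (q := 1 - t) (by linarith) (by linarith)).const_mul (1/a)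
  refine MeasureTheory.Integrable.mono' h ?_ ?_
  · apply Measurable.aestronglyMeasurable
    fun_prop
  · refine (MeasureTheory.ae_restrict_iff' measurableSet_Ioo).2 (Filter.Eventually.of_forall ?_)
    intro x hx
    have h2 : 0 < x := hx.1
    have h3 : 0 < 1 - x := by linarith [hx.2]
    rw [Real.norm_of_nonneg (by positivity), mul_comm t, ← Real.rpow_def_of_pos (by positivity),
      Real.div_rpow h2.le h3.le]
    have e1 : 1 + t - 1 = t := by ring
    have e2 : 1 - t - 1 = -t := by ring
    rw [e1, e2, Real.rpow_neg h3.le, ← div_eq_mul_inv, div_eq_mul_one_div, mul_comm]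
    apply mul_le_mul_of_nonneg_right _ (by positivity)
    exact one_div_le_one_div_of_le ha (by linarith)


open ProbabilityTheory MeasureTheory in
/-- Everything about the generating function of the integrals. -/
lemma mgf_facts {a : ℝ} (ha : 0 < a) : ∃ f : ℝ → ℝ, AnalyticAt ℝ f 0 ∧
    (∀ n : ℕ, iteratedDeriv n f 0 =
      ∫ x in Set.Ioo (0 : ℝ) 1, (Real.log (x / (1 - x)) / Real.pi) ^ n / (x + a)) ∧
    (fun s => Real.sin s * f s) =ᶠ[nhds 0]
      fun s => Real.pi * (1 - Real.exp (Real.log (a / (1+a)) / Real.pi * s)) := by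
  set w : ℝ → ENNReal := fun x => ENNReal.ofReal (1 / (x + a)) with hw
  set μ : Measure ℝ := (volume.restrict (Set.Ioo (0:ℝ) 1)).withDensity w with hμ
  set Y : ℝ → ℝ := fun x => Real.log (x / (1 - x)) / Real.pi with hY
  have hwm : Measurable w := by
    rw [hw]
    fun_prop
  have hint : ∀ g : ℝ → ℝ, ∫ x, g x ∂μ = ∫ x in Set.Ioo (0:ℝ) 1, g x / (x + a) := by
    intro g
    rw [hμ, integral_withDensity_eq_integral_toReal_smul hwm (by simp [hw])]
    refine setIntegral_congr_fun measurableSet_Ioo fun x hx => ?_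
    have : 0 < x + a := by linarith [hx.1]
    simp only [hw, smul_eq_mul]
    rw [ENNReal.toReal_ofReal (by positivity)]
    ring
  have hsub : Set.Ioo (-Real.pi) Real.pi ⊆ interior (integrableExpSet Y μ) := by
    apply interior_maximal _ isOpen_Ioo
    intro s hs
    change Integrable (fun x => Real.exp (s * Y x)) μ
    rw [hμ, integrable_withDensity_iff_integrable_smul' hwm (by simp [hw])]
    have h := mgf_integrable (t := s / Real.pi) (a := a)
      (by rw [lt_div_iff₀ Real.pi_pos]; linarith [hs.1])
      (by rw [div_lt_one Real.pi_pos]; exact hs.2) ha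
    refine (integrableOn_congr_fun ?_ measurableSet_Ioo).1 h
    intro x hx
    have : 0 < x + a := by linarith [hx.1]
    simp only [hw, smul_eq_mul, hY]
    rw [ENNReal.toReal_ofReal (by positivity), mul_comm_div s]
    ring
  have h0mem : (0:ℝ) ∈ Set.Ioo (-Real.pi) Real.pi := ⟨by linarith [Real.pi_pos], Real.pi_pos⟩
  have hana : AnalyticOnNhd ℝ (mgf Y μ) (Set.Ioo (-Real.pi) Real.pi) := analyticOnNhd_mgf.mono hsub
  refine ⟨mgf Y μ, hana 0 h0mem, ?_, ?_⟩
  · intro n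
    rw [iteratedDeriv_mgf_zero (hsub h0mem), hint]
    rfl
  · have heq : Set.EqOn (fun s => Real.sin s * mgf Y μ s)
        (fun s => Real.pi * (1 - Real.exp (Real.log (a / (1+a)) / Real.pi * s)))
        (Set.Ioo (-Real.pi) Real.pi) := by
      have hhalf : Real.pi / 2 ∈ Set.Ioo 0 Real.pi :=
        ⟨by linarith [Real.pi_pos], by linarith [Real.pi_pos]⟩
      apply AnalyticOnNhd.eqOn_of_preconnected_of_eventuallyEq (𝕜 := ℝ) (z₀ := Real.pi / 2)
      · exact fun s hs => Real.analyticAt_sin.mul (hana s hs)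
      · intro s _
        fun_prop
      · exact isPreconnected_Ioo
      · exact ⟨by linarith [Real.pi_pos], hhalf.2⟩
      · filter_upwards [isOpen_Ioo.mem_nhds hhalf] with s hs
        have h := mgf_value (t := s / Real.pi) (a := a) (div_pos hs.1 Real.pi_pos)
          (by rw [div_lt_one Real.pi_pos]; exact hs.2) ha
        have h1 : mgf Y μ s =
            ∫ x in Set.Ioo (0:ℝ) 1, Real.exp (s / Real.pi * Real.log (x / (1-x))) / (x + a) := by
          rw [mgf, hint]
          refine setIntegral_congr_fun measurableSet_Ioo fun x hx => ?_
          simp only [hY]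
          rw [mul_comm_div s]
        have h2 : Real.pi * (s / Real.pi) = s := mul_div_cancel₀ _ Real.pi_ne_zero
        rw [h2] at h
        have h3 : Real.sin s ≠ 0 := (Real.sin_pos_of_pos_of_lt_pi hs.1 hs.2).ne'
        rw [h1, h, mul_comm_div s, mul_comm s]
        field_simp
    exact heq.eventuallyEq_of_mem (isOpen_Ioo.mem_nhds h0mem)

/-- Taylor series at the origin, with complex coefficients. -/
noncomputable def taylorSer (f : ℝ → ℝ) : PowerSeries ℂ :=
  PowerSeries.mk fun n => ((iteratedDeriv n f 0 : ℝ) : ℂ) / (n.factorial : ℂ)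

lemma taylorSer_congr {f g : ℝ → ℝ} (h : f =ᶠ[nhds 0] g) : taylorSer f = taylorSer g := by
  ext n
  simp only [taylorSer, PowerSeries.coeff_mk]
  rw [h.iteratedDeriv_eq]

lemma taylorSer_deriv (f : ℝ → ℝ) :
    PowerSeries.derivative ℂ (taylorSer f) = taylorSer (deriv f) := by
  ext n
  rw [PowerSeries.coeff_derivative]
  simp only [taylorSer, PowerSeries.coeff_mk]
  rw [iteratedDeriv_succ', Nat.factorial_succ]
  have : (n.factorial : ℂ) ≠ 0 := by exact_mod_cast n.factorial_ne_zero
  have h2 : (n + 1 : ℂ) ≠ 0 := by exact_mod_cast n.succ_ne_zero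
  push_cast
  field_simp

lemma taylorSer_mul {f g : ℝ → ℝ} (hf : AnalyticAt ℝ f 0) (hg : AnalyticAt ℝ g 0) :
    taylorSer (fun s => f s * g s) = taylorSer f * taylorSer g := by
  ext n
  rw [PowerSeries.coeff_mul, Finset.Nat.sum_antidiagonal_eq_sum_range_succ_mk]
  simp only [taylorSer, PowerSeries.coeff_mk]
  rw [iteratedDeriv_fun_mul hf.contDiffAt hg.contDiffAt]
  push_cast
  rw [Finset.sum_div]
  refine Finset.sum_congr rfl fun k hk => ?_
  have hk' : k ≤ n := by
    have := Finset.mem_range.1 hk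
    omega
  rw [Nat.cast_choose ℂ hk']
  have h1 : (n.factorial : ℂ) ≠ 0 := by exact_mod_cast n.factorial_ne_zero
  have h2 : (k.factorial : ℂ) ≠ 0 := by exact_mod_cast k.factorial_ne_zero
  have h3 : ((n-k).factorial : ℂ) ≠ 0 := by exact_mod_cast (n-k).factorial_ne_zero
  field_simp

theorem stmt15 (n : ℕ) (a : ℝ) (ha : 0 < a) :
    ((∫ x in Set.Ioo (0 : ℝ) 1, (Real.log (x / (1 - x))) ^ n / (x + a) : ℝ) : ℂ) =
      -(Real.pi : ℂ) ^ (n + 1) *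
        (polyA n).eval ((Real.log (a / (1 + a)) : ℂ) / (Real.pi : ℂ)) := by
  obtain ⟨f, hf, hmom, hev⟩ := mgf_facts ha
  set z : ℂ := (Real.log (a / (1 + a)) : ℂ) / (Real.pi : ℂ) with hz
  have hsin : PowerSeries.derivative ℂ (taylorSer Real.sin) = taylorSer Real.cos := by
    rw [taylorSer_deriv, Real.deriv_sin]
  have hcos : PowerSeries.derivative ℂ (taylorSer Real.cos) = -taylorSer Real.sin := by
    rw [taylorSer_deriv, Real.deriv_cos']
    ext n
    rw [map_neg]
    simp only [taylorSer, PowerSeries.coeff_mk]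
    rw [iteratedDeriv_fun_neg]
    push_cast
    ring
  have hs0 : PowerSeries.coeff 0 (taylorSer Real.sin) = 0 := by simp [taylorSer]
  have hc0 : PowerSeries.coeff 0 (taylorSer Real.cos) = 1 := by simp [taylorSer]
  have hA := serA_formula _ _ hsin hcos hs0 hc0 z
  have hne : taylorSer Real.sin ≠ 0 := by
    intro h
    rw [h, map_zero] at hsin
    rw [← hsin] at hc0
    simp at hc0
  have hE : taylorSer (fun s => Real.pi * (1 - Real.exp (Real.log (a / (1+a)) / Real.pi * s)))
      = PowerSeries.C (-(Real.pi : ℂ)) * (serE z - 1) := by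
    ext m
    rw [PowerSeries.coeff_C_mul, map_sub, PowerSeries.coeff_one]
    simp only [taylorSer, serE, PowerSeries.coeff_mk]
    rw [iteratedDeriv_const_mul_field]
    cases m with
    | zero => simp
    | succ m =>
      rw [iteratedDeriv_const_sub (Nat.succ_pos m), iteratedDeriv_neg, iteratedDeriv_exp_const_mul]
      simp [hz]
      ring
  have hmul := taylorSer_mul Real.analyticAt_sin hf
  rw [taylorSer_congr hev, hE, ← hA, mul_left_comm] at hmul
  have hser := congrArg (PowerSeries.coeff n) (mul_left_cancel₀ hne hmul)
  rw [PowerSeries.coeff_C_mul] at hser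
  simp only [serA, taylorSer, PowerSeries.coeff_mk] at hser
  have hfac : (n.factorial : ℂ) ≠ 0 := by exact_mod_cast n.factorial_ne_zero
  have hpi : (Real.pi : ℂ) ≠ 0 := by exact_mod_cast Real.pi_ne_zero
  have hI : iteratedDeriv n f 0 =
      (∫ x in Set.Ioo (0 : ℝ) 1, (Real.log (x / (1 - x))) ^ n / (x + a)) / Real.pi ^ n := by
    rw [hmom, ← MeasureTheory.integral_div]
    refine MeasureTheory.setIntegral_congr_fun measurableSet_Ioo fun x _ => ?_
    simp only [div_pow]
    ring
  rw [hI] at hser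
  push_cast at hser
  field_simp at hser
  rw [← hser]
  ring
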